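/- Let n, d be positive integers, a ∈ ℝ^d. Let M : ℝ → ℝ^{n×n} be differentiable with each M(t) symmetric, C : ℝ → ℝ^{n×n}, K ∈ ℝ^{n×n}, and Y, Ŷ : ℝ → ℝ^{n×d}. Let P ∈ ℝ^{d×d} be symmetric positive definite, let ψ : ℝ^d → ℝ be twice continuously differentiable with ∇²ψ(Pâ(t)) invertible for all t, let s : ℝ → ℝ^n be differentiable, and let â : ℝ → ℝ^d be differentiable. Suppose for all t: (i) M'(t) − 2C(t) is skew-symmetric; (ii) M(t)s'(t) + (C(t) + K)s(t) = Y(t)a − Ŷ(t)â(t); and (iii) the adaptation law â'(t) = P⁻¹(∇²ψ(Pâ(t)))⁻¹P⁻¹ Ŷ(t)ᵀ s(t) holds. Then the Lyapunov-like function V(t) = ½ s(t)ᵀ M(t) s(t) + d_ψ(Pa ‖ Pâ(t)) is differentiable with V'(t) = −s(t)ᵀ K s(t) + s(t)ᵀ (Y(t) − Ŷ(t)) a for every t. -/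

import Mathlib

open scoped Matrix.Norms.L2Operator RealInnerProductSpace Matrix

/-- Application of a real matrix to a vector of `EuclideanSpace`. -/
noncomputable def mApp {n m : ℕ} (A : Matrix (Fin n) (Fin m) ℝ)
    (v : EuclideanSpace ℝ (Fin m)) : EuclideanSpace ℝ (Fin n) :=
  Matrix.toEuclideanLin A v

/-- The Bregman divergence `d_ψ(y ‖ x) = ψ(y) − ψ(x) − ⟨∇ψ(x), y − x⟩`. -/
noncomputable def bregman {d : ℕ} (ψ : EuclideanSpace ℝ (Fin d) → ℝ)
    (y x : EuclideanSpace ℝ (Fin d)) : ℝ :=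
  ψ y - ψ x - ⟪gradient ψ x, y - x⟫

theorem mApp_inner {n m : ℕ} (A : Matrix (Fin n) (Fin m) ℝ)
    (v : EuclideanSpace ℝ (Fin m)) (w : EuclideanSpace ℝ (Fin n)) :
    ⟪w, mApp A v⟫ = ⟪mApp Aᵀ w, v⟫ := by
  have h := LinearMap.adjoint_inner_left (Matrix.toEuclideanLin A) v w
  rw [← Matrix.toEuclideanLin_conjTranspose_eq_adjoint, Matrix.conjTranspose_eq_transpose_of_trivial] at h
  exact h.symm

theorem mApp_add {n m : ℕ} (A B : Matrix (Fin n) (Fin m) ℝ)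
    (v : EuclideanSpace ℝ (Fin m)) : mApp (A + B) v = mApp A v + mApp B v := by
  simp [mApp]

theorem mApp_sub {n m : ℕ} (A B : Matrix (Fin n) (Fin m) ℝ)
    (v : EuclideanSpace ℝ (Fin m)) : mApp (A - B) v = mApp A v - mApp B v := by
  simp [mApp]

theorem mApp_neg {n m : ℕ} (A : Matrix (Fin n) (Fin m) ℝ)
    (v : EuclideanSpace ℝ (Fin m)) : mApp (-A) v = - mApp A v := by
  simp [mApp]

theorem mApp_vsub {n m : ℕ} (A : Matrix (Fin n) (Fin m) ℝ)
    (v w : EuclideanSpace ℝ (Fin m)) : mApp A (v - w) = mApp A v - mApp A w := by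
  simp [mApp]

theorem mApp_mul {n m k : ℕ} (A : Matrix (Fin n) (Fin m) ℝ) (B : Matrix (Fin m) (Fin k) ℝ)
    (v : EuclideanSpace ℝ (Fin k)) : mApp A (mApp B v) = mApp (A * B) v := by
  simp [mApp, Matrix.toLpLin_apply]

theorem mApp_one {n : ℕ} (v : EuclideanSpace ℝ (Fin n)) : mApp 1 v = v := by
  simp [mApp]

theorem mApp_hasDerivAt {n : ℕ} {M : ℝ → Matrix (Fin n) (Fin n) ℝ}
    {M' : Matrix (Fin n) (Fin n) ℝ} {s : ℝ → EuclideanSpace ℝ (Fin n)}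
    {s' : EuclideanSpace ℝ (Fin n)} {t : ℝ}
    (hM : HasDerivAt M M' t) (hs : HasDerivAt s s' t) :
    HasDerivAt (fun τ => mApp (M τ) (s τ)) (mApp M' (s t) + mApp (M t) s') t := by
  let L : Matrix (Fin n) (Fin n) ℝ →L[ℝ] (EuclideanSpace ℝ (Fin n) →L[ℝ] EuclideanSpace ℝ (Fin n)) :=
    LinearMap.toContinuousLinearMap
      ((LinearMap.toContinuousLinearMap.toLinearMap).comp
        (Matrix.toEuclideanLin (𝕜 := ℝ) (m := Fin n) (n := Fin n)).toLinearMap)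
  exact (L.hasFDerivAt.comp_hasDerivAt t hM).clm_apply hs

theorem gradient_differentiable {d : ℕ} {ψ : EuclideanSpace ℝ (Fin d) → ℝ}
    (hψ : ContDiff ℝ 2 ψ) : Differentiable ℝ (gradient ψ) := by
  have h : Differentiable ℝ (fderiv ℝ ψ) :=
    (hψ.fderiv_right (m := 1) (by norm_num)).differentiable (by norm_num)
  intro x
  exact ((InnerProductSpace.toDual ℝ (EuclideanSpace ℝ (Fin d))).symm.toContinuousLinearEquiv
    |>.differentiableAt).comp x (h x)

/-- Lyapunov dissipation identity: under the mirror-descent adaptation law, the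
Lyapunov-like function `V(t) = ½ s(t)ᵀ M(t) s(t) + d_ψ(Pa ‖ Pâ(t))` has derivative
`V'(t) = −s(t)ᵀ K s(t) + s(t)ᵀ (Y(t) − Ŷ(t)) a`. Here the Hessian `∇²ψ` is the
Fréchet derivative of the gradient of `ψ`, and its inverse is `Ring.inverse` in the
ring of continuous linear endomorphisms. -/
theorem stmt_4 {n d : ℕ} (hn : 0 < n) (hd : 0 < d)
    (a : EuclideanSpace ℝ (Fin d))
    (M : ℝ → Matrix (Fin n) (Fin n) ℝ) (hM : Differentiable ℝ M)
    (hMsymm : ∀ t, (M t).IsSymm)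
    (C : ℝ → Matrix (Fin n) (Fin n) ℝ) (K : Matrix (Fin n) (Fin n) ℝ)
    (Y Yh : ℝ → Matrix (Fin n) (Fin d) ℝ)
    (P : Matrix (Fin d) (Fin d) ℝ) (hP : P.PosDef)
    (ψ : EuclideanSpace ℝ (Fin d) → ℝ) (hψ : ContDiff ℝ 2 ψ)
    (s : ℝ → EuclideanSpace ℝ (Fin n)) (hs : Differentiable ℝ s)
    (ah : ℝ → EuclideanSpace ℝ (Fin d)) (hah : Differentiable ℝ ah)
    (hHessInv : ∀ t : ℝ, IsUnit (fderiv ℝ (gradient ψ) (mApp P (ah t))))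
    (hskew : ∀ t, (deriv M t - 2 • C t)ᵀ = -(deriv M t - 2 • C t))
    (hdyn : ∀ t, mApp (M t) (deriv s t) + mApp (C t + K) (s t)
      = mApp (Y t) a - mApp (Yh t) (ah t))
    (hadapt : ∀ t, deriv ah t = mApp P⁻¹
      ((Ring.inverse (fderiv ℝ (gradient ψ) (mApp P (ah t))))
        (mApp P⁻¹ (mApp (Yh t)ᵀ (s t))))) :
    ∀ t : ℝ, HasDerivAt
      (fun τ => (1 / 2 : ℝ) * ⟪s τ, mApp (M τ) (s τ)⟫ + bregman ψ (mApp P a) (mApp P (ah τ)))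
      (-⟪s t, mApp K (s t)⟫ + ⟪s t, mApp (Y t - Yh t) a⟫) t := by
  intro t
  have hs' := (hs t).hasDerivAt
  have h1 := (hs'.inner ℝ (mApp_hasDerivAt (hM t).hasDerivAt hs')).const_mul (1 / 2 : ℝ)
  have hPu : IsUnit P.det := hP.isUnit.map Matrix.detMonoidHom
  have hPT : Pᵀ = P := by
    have := hP.1.eq
    rwa [Matrix.conjTranspose_eq_transpose_of_trivial] at this
  set u := mApp (Yh t)ᵀ (s t) with hu
  set x : ℝ → EuclideanSpace ℝ (Fin d) := fun τ => mApp P (ah τ) with hx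
  set H := fderiv ℝ (gradient ψ) (x t) with hH
  set x' := mApp P (deriv ah t) with hx'
  have hxd : HasDerivAt x x' t :=
    (LinearMap.toContinuousLinearMap (Matrix.toEuclideanLin P)).hasFDerivAt.comp_hasDerivAt t
      (hah t).hasDerivAt
  have hHx : H x' = mApp P⁻¹ u := by
    rw [hx', hadapt t, mApp_mul, Matrix.mul_nonsing_inv _ hPu, mApp_one,
      ← mul_apply_eq_comp, Ring.mul_inverse_cancel _ (hHessInv t)]
    rfl
  have hg : HasDerivAt (fun τ => gradient ψ (x τ)) (H x') t :=
    (gradient_differentiable hψ (x t)).hasFDerivAt.comp_hasDerivAt t hxd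
  have hp : HasDerivAt (fun τ => ψ (x τ)) ⟪gradient ψ (x t), x'⟫ t := by
    have hd1 : DifferentiableAt ℝ ψ (x t) := hψ.differentiable (by norm_num) (x t)
    have := hd1.hasGradientAt.hasFDerivAt.comp_hasDerivAt t hxd
    exact this
  have h2 := (hp.const_sub (ψ (mApp P a))).sub (hg.inner ℝ (hxd.const_sub (mApp P a)))
  refine (h1.add h2).congr_deriv ?_
  have e1 : ⟪H x', mApp P a - x t⟫ = ⟪s t, mApp (Yh t) a⟫ - ⟪s t, mApp (Yh t) (ah t)⟫ := by
    rw [hHx, hx, ← mApp_vsub, mApp_inner, hPT, mApp_mul, Matrix.mul_nonsing_inv _ hPu, mApp_one,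
      hu, ← mApp_inner, mApp_vsub, inner_sub_right]
  have e2 : ⟪deriv s t, mApp (M t) (s t)⟫ = ⟪s t, mApp (M t) (deriv s t)⟫ := by
    rw [mApp_inner, (hMsymm t).eq, real_inner_comm]
  have e3 : ⟪s t, mApp (deriv M t) (s t)⟫ = 2 * ⟪s t, mApp (C t) (s t)⟫ := by
    have h := mApp_inner (deriv M t - 2 • C t) (s t) (s t)
    rw [hskew t, mApp_neg, inner_neg_left, real_inner_comm, two_smul, mApp_sub, mApp_add,
      inner_sub_left, inner_add_left, real_inner_comm, real_inner_comm _ (mApp (C t) (s t))] at h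
    linarith [real_inner_comm (s t) (mApp (deriv M t) (s t)),
      real_inner_comm (s t) (mApp (C t) (s t))]
  have e4 := congrArg (fun z => ⟪s t, z⟫) (hdyn t)
  simp only [mApp_add, inner_add_right, inner_sub_right] at e4
  simp only [inner_add_right, inner_neg_right, mApp_sub, inner_sub_right] at e1 ⊢
  rw [e2, e3]
  linarith
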